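/- Let k = 6 and let F be the field of fractions of ℚ[x_{ij} : 1 ≤ i < j ≤ 6]. The 19 vectors in the 20-dimensional F-vector space of F-valued functions on triples r < s < t of elements of {1,...,6}, consisting of the 18 partial-conjugation translation vectors V(1,2), V(1,3), V(1,4), V(1,5), V(2,1), V(2,3), V(2,4), V(2,5), V(3,1), V(3,2), V(3,4), V(3,5), V(4,1), V(4,2), V(4,3), V(4,5), V(5,1), V(5,2), together with the reversion vector R given by R(r,s,t) = −x_{rs}x_{rt} + x_{rs}x_{st} − x_{rt}x_{st}, are linearly independent over F. (This is the computational claim, verified by Mathematica in the paper, underlying the explicit construction of the invariant for 6-component links via 19×19 cofactor determinants.) -/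

import Mathlib

noncomputable section

/-- The index set of the commuting indeterminates `x_{ij}`: one for each unordered
pair of distinct indices in `Fin 6`. -/
abbrev LinkingVar := {p : Sym2 (Fin 6) // ¬ p.IsDiag}

/-- The polynomial ring `ℚ[x_{ij} : 1 ≤ i < j ≤ 6]`. -/
abbrev LinkingPoly := MvPolynomial LinkingVar ℚ

/-- The field of fractions `F` of `ℚ[x_{ij} : 1 ≤ i < j ≤ 6]`. -/
abbrev LinkingField := FractionRing LinkingPoly

/-- The generic linking number `x_{ij} = x_{ji}` attached to the unordered pair
`{i,j}` of distinct indices (junk value `0` when `i = j`), viewed in `F`. -/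
def genericLinking (i j : Fin 6) : LinkingField :=
  algebraMap LinkingPoly LinkingField
    (if h : i = j then 0
     else MvPolynomial.X ⟨s(i, j), by simp [Sym2.mk_isDiag_iff, h]⟩)

/-- The set of triples `r < s < t` of elements of `Fin 6`; there are exactly 20 of
them, so the `F`-valued functions on them form a 20-dimensional `F`-vector space. -/
abbrev OrderedTriple :=
  {T : Fin 6 × Fin 6 × Fin 6 // T.1 < T.2.1 ∧ T.2.1 < T.2.2}

/-- The partial-conjugation translation vector `V(i,j)` of Lemma 2.5, as an `F`-valued
function on the triples `r < s < t`.  It vanishes if `{i,j} ⊄ {r,s,t}`, and on a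
triple `r < s < t`: `V(r,s) = x_{rt}`, `V(r,t) = −x_{rs}`, `V(s,r) = −x_{st}`,
`V(s,t) = x_{rs}`, `V(t,r) = x_{st}`, `V(t,s) = −x_{rt}`. -/
def partialConjVec (i j : Fin 6) : OrderedTriple → LinkingField := fun T =>
  let r := T.val.1; let s := T.val.2.1; let t := T.val.2.2
  (if i = r ∧ j = s then genericLinking r t else 0) +
  (if i = r ∧ j = t then -(genericLinking r s) else 0) +
  (if i = s ∧ j = r then -(genericLinking s t) else 0) +
  (if i = s ∧ j = t then genericLinking r s else 0) +
  (if i = t ∧ j = r then genericLinking s t else 0) +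
  (if i = t ∧ j = s then -(genericLinking r t) else 0)

/-- The reversion vector `R` of Theorem 2.8:
`R(r,s,t) = −x_{rs}x_{rt} + x_{rs}x_{st} − x_{rt}x_{st}`. -/
def reversionVec : OrderedTriple → LinkingField := fun T =>
  let r := T.val.1; let s := T.val.2.1; let t := T.val.2.2
  (-(genericLinking r s * genericLinking r t) +
    genericLinking r s * genericLinking s t -
    genericLinking r t * genericLinking s t)

section Specialization

variable {ι κ R K : Type*} [Fintype ι] [Fintype κ]

/-- A family of vectors over a domain is linearly independent as soon as its image under some
ring homomorphism to an ordered field is: its Gram determinant does not vanish. -/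
theorem LinearIndependent.of_ringHom_comp [CommRing R] [IsDomain R] [Field K] [LinearOrder K]
    [IsStrictOrderedRing K] (φ : R →+* K) {v : ι → κ → R}
    (hv : LinearIndependent K fun i k => φ (v i k)) : LinearIndependent R v := by
  classical
  set N : Matrix ι κ K := Matrix.of fun i k => φ (v i k) with hN
  set M : Matrix ι κ R := Matrix.of v with hM
  have hdetN : (N * N.transpose).det ≠ 0 := by
    intro h
    obtain ⟨w, hw, hw0⟩ := Matrix.exists_mulVec_eq_zero_iff.mpr h
    refine hw ((Matrix.vecMul_injective_iff (M := N)).mpr hv ?_)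
    have hker := N.transpose.ker_mulVecLin_transpose_mul_self
    have hmem : w ∈ LinearMap.ker N.transpose.mulVecLin := by
      rwa [← hker, Matrix.transpose_transpose]
    simpa [Matrix.mulVec_transpose] using hmem
  have hdetM : (M * M.transpose).det ≠ 0 := by
    intro h
    apply hdetN
    have hmap : N * N.transpose = φ.mapMatrix (M * M.transpose) := by
      ext i j
      simp [hN, hM, Matrix.mul_apply]
    rw [hmap, ← RingHom.map_det, h, map_zero]
  rw [← show M.row = v from rfl, ← Matrix.vecMul_injective_iff]
  refine (injective_iff_map_eq_zero M.vecMulLinear).mpr fun w hw => ?_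
  replace hw : Matrix.vecMul w M = 0 := hw
  refine Matrix.eq_zero_of_vecMul_eq_zero hdetM ?_
  rw [← Matrix.vecMul_vecMul, hw, Matrix.zero_vecMul]

end Specialization

section Family

variable {R S : Type*} [CommRing R] [CommRing S]

/-- The partial-conjugation translation vector for linking numbers in an arbitrary ring. -/
def conjVec (x : Fin 6 → Fin 6 → R) (i j : Fin 6) : OrderedTriple → R := fun T =>
  let r := T.val.1; let s := T.val.2.1; let t := T.val.2.2
  (if i = r ∧ j = s then x r t else 0) +
  (if i = r ∧ j = t then -(x r s) else 0) +
  (if i = s ∧ j = r then -(x s t) else 0) +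
  (if i = s ∧ j = t then x r s else 0) +
  (if i = t ∧ j = r then x s t else 0) +
  (if i = t ∧ j = s then -(x r t) else 0)

/-- The reversion vector for linking numbers in an arbitrary ring. -/
def revVec (x : Fin 6 → Fin 6 → R) : OrderedTriple → R := fun T =>
  let r := T.val.1; let s := T.val.2.1; let t := T.val.2.2
  (-(x r s * x r t) + x r s * x s t - x r t * x s t)

/-- The nineteen translation vectors for linking numbers in an arbitrary ring. -/
def translationFamily (x : Fin 6 → Fin 6 → R) : Fin 19 → OrderedTriple → R :=
  ![conjVec x 0 1, conjVec x 0 2, conjVec x 0 3, conjVec x 0 4,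
    conjVec x 1 0, conjVec x 1 2, conjVec x 1 3, conjVec x 1 4,
    conjVec x 2 0, conjVec x 2 1, conjVec x 2 3, conjVec x 2 4,
    conjVec x 3 0, conjVec x 3 1, conjVec x 3 2, conjVec x 3 4,
    conjVec x 4 0, conjVec x 4 1, revVec x]

theorem map_conjVec (φ : R →+* S) (x : Fin 6 → Fin 6 → R) (i j : Fin 6) (T : OrderedTriple) :
    φ (conjVec x i j T) = conjVec (fun a b => φ (x a b)) i j T := by
  simp only [conjVec, map_add, apply_ite φ, map_neg, map_zero]

theorem map_revVec (φ : R →+* S) (x : Fin 6 → Fin 6 → R) (T : OrderedTriple) :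
    φ (revVec x T) = revVec (fun a b => φ (x a b)) T := by
  simp [revVec]

theorem map_translationFamily (φ : R →+* S) (x : Fin 6 → Fin 6 → R) (n : Fin 19)
    (T : OrderedTriple) :
    φ (translationFamily x n T) = translationFamily (fun a b => φ (x a b)) n T := by
  fin_cases n <;> first | exact map_conjVec .. | exact map_revVec ..

end Family

/-- The generic linking number as a polynomial. -/
def linkingPoly (i j : Fin 6) : LinkingPoly :=
  if h : i = j then 0 else MvPolynomial.X ⟨s(i, j), by simp [Sym2.mk_isDiag_iff, h]⟩

/-- A sparse choice of linking numbers: the adjacency matrix of a graph with eight edges. -/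
def sampleLinking : Matrix (Fin 6) (Fin 6) ℚ :=
  !![0, 0, 1, 0, 0, 1;
     0, 0, 0, 1, 1, 1;
     1, 0, 0, 0, 1, 1;
     0, 1, 0, 0, 0, 1;
     0, 1, 1, 0, 0, 0;
     1, 1, 1, 1, 0, 0]

theorem sampleLinking_symm (i j : Fin 6) : sampleLinking i j = sampleLinking j i := by
  fin_cases i <;> fin_cases j <;> rfl

theorem sampleLinking_self (i : Fin 6) : sampleLinking i i = 0 := by
  fin_cases i <;> rfl

theorem eval_linkingPoly (i j : Fin 6) :
    MvPolynomial.eval (fun p : LinkingVar => Sym2.lift ⟨sampleLinking, sampleLinking_symm⟩ p.1)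
      (linkingPoly i j) = sampleLinking i j := by
  by_cases h : i = j
  · subst h
    simp [linkingPoly, sampleLinking_self]
  · simp [linkingPoly, h]

theorem linearIndependent_translationFamily_sampleLinking :
    LinearIndependent ℚ (translationFamily sampleLinking) := by
  rw [Fintype.linearIndependent_iff]
  intro c hc
  have key (r s t : Fin 6) (h : r < s ∧ s < t) :
      ∑ n, c n * translationFamily sampleLinking n ⟨(r, s, t), h⟩ = 0 := by
    simpa using congrFun hc ⟨(r, s, t), h⟩
  have h012 := key 0 1 2 (by decide)
  have h013 := key 0 1 3 (by decide)
  have h014 := key 0 1 4 (by decide)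
  have h015 := key 0 1 5 (by decide)
  have h023 := key 0 2 3 (by decide)
  have h024 := key 0 2 4 (by decide)
  have h025 := key 0 2 5 (by decide)
  have h035 := key 0 3 5 (by decide)
  have h045 := key 0 4 5 (by decide)
  have h123 := key 1 2 3 (by decide)
  have h124 := key 1 2 4 (by decide)
  have h125 := key 1 2 5 (by decide)
  have h134 := key 1 3 4 (by decide)
  have h135 := key 1 3 5 (by decide)
  have h145 := key 1 4 5 (by decide)
  have h234 := key 2 3 4 (by decide)
  have h235 := key 2 3 5 (by decide)
  have h245 := key 2 4 5 (by decide)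
  have h345 := key 3 4 5 (by decide)
  simp [Fin.sum_univ_succ, translationFamily, conjVec, revVec, sampleLinking]
    at h012 h013 h014 h015 h023 h024 h025 h035 h045
      h123 h124 h125 h134 h135 h145 h234 h235 h245 h345
  intro n
  fin_cases n <;> simp <;> linarith

/-- The computational claim of Section 3 (components numbered `1,…,6`, here `0,…,5`):
the 18 partial-conjugation translation vectors `V(1,2), V(1,3), V(1,4), V(1,5),
V(2,1), V(2,3), V(2,4), V(2,5), V(3,1), V(3,2), V(3,4), V(3,5), V(4,1), V(4,2),
V(4,3), V(4,5), V(5,1), V(5,2)` together with the reversion vector `R` are linearly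
independent over `F` in the 20-dimensional space of `F`-valued functions on
triples. -/
theorem nineteen_vectors_linearIndependent :
    LinearIndependent LinkingField
      (![partialConjVec 0 1, partialConjVec 0 2, partialConjVec 0 3, partialConjVec 0 4,
        partialConjVec 1 0, partialConjVec 1 2, partialConjVec 1 3, partialConjVec 1 4,
        partialConjVec 2 0, partialConjVec 2 1, partialConjVec 2 3, partialConjVec 2 4,
        partialConjVec 3 0, partialConjVec 3 1, partialConjVec 3 2, partialConjVec 3 4,
        partialConjVec 4 0, partialConjVec 4 1, reversionVec] :
        Fin 19 → (OrderedTriple → LinkingField)) := by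
  have hpoly : LinearIndependent LinkingPoly (translationFamily linkingPoly) := by
    refine .of_ringHom_comp
      (MvPolynomial.eval fun p => Sym2.lift ⟨sampleLinking, sampleLinking_symm⟩ p.1) ?_
    simpa only [map_translationFamily, eval_linkingPoly]
      using linearIndependent_translationFamily_sampleLinking
  have hmap := hpoly.map_injOn
    (LinearMap.compLeft (Algebra.linearMap LinkingPoly LinkingField) OrderedTriple)
    ((IsFractionRing.injective LinkingPoly LinkingField).comp_left.injOn)
  have hgeneric : LinearMap.compLeft (Algebra.linearMap LinkingPoly LinkingField) OrderedTriple ∘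
      translationFamily linkingPoly = translationFamily genericLinking := by
    ext n T
    exact map_translationFamily (algebraMap LinkingPoly LinkingField) linkingPoly n T
  rw [hgeneric] at hmap
  exact (LinearIndependent.iff_fractionRing LinkingPoly LinkingField).mp hmap

end
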